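/- arXiv:2103.08383 — 2 statements merged into one kernel-verified Lean document; each statement's English description precedes it below -/
import Mathlib

section
/- Let $\nu,\mu$ be Markov fields on $\mathcal{S}^{\mathbb{I}}$ with transition kernels $P_n, Q_n$, with $\nu\in\mathscr{R}$ (i.e., $\liminf_n \nu(\mathbb{X}_n=s)>0$ for each $s$) and $\nu\overset{loc}{\ll}\mu$. If $\nu \ll \mu$, then $\sum_{n\geq 1} D_n^2(\nu,\mu) < \infty$, where $D_n^2(\nu,\mu) = \sum_{s,t\in\mathbb{S}}\left(\sqrt{P_n(s,t)}-\sqrt{Q_n(s,t)}\right)^2$. -/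
open MeasureTheory ProbabilityTheory Filter Set

noncomputable section

variable {S : Type*} [Fintype S] [MeasurableSpace S] [MeasurableSingletonClass S]

/-- The pair variable `𝕏_n = (X_{-n}, X_n)` on the two-sided sequence space `S^ℤ`. -/
def XX (n : ℕ) (x : ℤ → S) : S × S := (x (-(n : ℤ)), x (n : ℤ))

/-- The natural filtration `𝒜_n = σ(X_i : |i| ≤ n)` on `S^ℤ`. -/
def Acal (S : Type*) [MeasurableSpace S] (n : ℕ) : MeasurableSpace (ℤ → S) :=
  MeasurableSpace.comap (fun x (k : {k : ℤ // |k| ≤ (n : ℤ)}) => x (k : ℤ))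
    MeasurableSpace.pi

/-- `σ(X_k : |k| < n)`. -/
def innerSA (S : Type*) [MeasurableSpace S] (n : ℤ) : MeasurableSpace (ℤ → S) :=
  MeasurableSpace.comap (fun x (k : {k : ℤ // |k| < n}) => x (k : ℤ))
    MeasurableSpace.pi

/-- `σ(X_k : |k| > n)`. -/
def outerSA (S : Type*) [MeasurableSpace S] (n : ℤ) : MeasurableSpace (ℤ → S) :=
  MeasurableSpace.comap (fun x (k : {k : ℤ // n < |k|}) => x (k : ℤ))
    MeasurableSpace.pi

/-- The (two-sided) tail σ-algebra `⋂_{n ≥ 1} σ(X_k : |k| > n)`. -/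
def tailSA (S : Type*) [MeasurableSpace S] : MeasurableSpace (ℤ → S) :=
  ⨅ n : ℕ, outerSA S ((n : ℤ) + 1)

/-- `ν` is a Markov field on `S^ℤ`: for every `n ≥ 1`, `σ(X_k : |k| < n)` and
`σ(X_k : |k| > n)` are conditionally independent given `σ(X_k : |k| = n)`, i.e. given each
atom `{(X_{-n}, X_n) = c}`. -/
def IsMarkovField (ν : Measure (ℤ → S)) : Prop :=
  ∀ n : ℤ, 1 ≤ n → ∀ A B : Set (ℤ → S),
    MeasurableSet[innerSA S n] A → MeasurableSet[outerSA S n] B →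
    ∀ c : S × S,
      ν (A ∩ B ∩ {x | (x (-n), x n) = c}) * ν {x | (x (-n), x n) = c} =
        ν (A ∩ {x | (x (-n), x n) = c}) * ν (B ∩ {x | (x (-n), x n) = c})

/-- `f(n,m) = min {|n|, |m|, |n-m|}` (for indices `n, m ≥ 0`). -/
def fmin (p : ℕ × ℕ) : ℕ := min (min p.1 p.2) (Nat.dist p.1 p.2)

/-- The class `𝒮`: `liminf_{f(n,m) → ∞} ν(𝕏_n = s, 𝕏_m = t) > 0` for all `s, t`. -/
def classS (ν : Measure (ℤ → S)) : Prop :=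
  ∀ s t : S × S,
    0 < Filter.liminf (fun p : ℕ × ℕ => ν {x | XX p.1 x = s ∧ XX p.2 x = t})
        (Filter.comap fmin Filter.atTop)

/-- The class `ℛ`: `liminf_n ν(𝕏_n = s) > 0` for all `s`. -/
def classR (ν : Measure (ℤ → S)) : Prop :=
  ∀ s : S × S, 0 < Filter.liminf (fun n : ℕ => ν {x | XX n x = s}) Filter.atTop

/-- The history `(𝕏_0, …, 𝕏_{n-1})`. -/
def hist (n : ℕ) (x : ℤ → S) : Fin n → S × S := fun i => XX (i : ℕ) x

/-- The mass of a history followed by a state. -/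
def pmass (ν : Measure (ℤ → S)) (n : ℕ) (w : Fin n → S × S) (s : S × S) : ℝ :=
  ν.real {x | hist n x = w ∧ XX n x = s}

/-- Hellinger affinity restricted to `𝕏_n = s`. -/
def Hell (ν μ : Measure (ℤ → S)) (n : ℕ) (s : S × S) : ℝ :=
  ∑ w : Fin n → S × S, Real.sqrt (pmass ν n w s) * Real.sqrt (pmass μ n w s)

lemma hist_snoc (n : ℕ) (x : ℤ → S) (w : Fin n → S × S) (s : S × S) :
    hist (n + 1) x = Fin.snoc (α := fun _ => S × S) w s ↔ hist n x = w ∧ XX n x = s := by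
  constructor
  · intro h
    constructor
    · funext i
      have := congrFun h i.castSucc
      simpa [hist] using this
    · have := congrFun h (Fin.last n)
      simpa [hist] using this
  · rintro ⟨rfl, rfl⟩
    funext i
    refine Fin.lastCases ?_ (fun j => ?_) i
    · simp [hist]
    · simp [hist]

lemma meas_coord (p : ℤ → Prop) (k : ℤ) (hk : p k) (a : S) :
    MeasurableSet[MeasurableSpace.comap (fun (x : ℤ → S) (k : {k : ℤ // p k}) => x (k : ℤ))
      MeasurableSpace.pi] {x | x k = a} := by
  refine ⟨{y | y ⟨k, hk⟩ = a}, ?_, rfl⟩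
  exact (measurable_pi_apply (X := fun _ : {k : ℤ // p k} => S) ⟨k, hk⟩) (measurableSet_singleton a)

lemma meas_XX (p : ℤ → Prop) (n : ℕ) (hk : p n) (hk' : p (-n)) (s : S × S) :
    MeasurableSet[MeasurableSpace.comap (fun (x : ℤ → S) (k : {k : ℤ // p k}) => x (k : ℤ))
      MeasurableSpace.pi] {x | XX n x = s} := by
  have : {x : ℤ → S | XX n x = s} = {x | x (-(n:ℤ)) = s.1} ∩ {x | x (n:ℤ) = s.2} := by
    ext x; simp [XX, Prod.ext_iff]
  rw [this]
  exact MeasurableSet.inter (meas_coord p _ hk' _) (meas_coord p _ hk _)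

lemma meas_hist (n : ℕ) (w : Fin n → S × S) :
    MeasurableSet[innerSA S n] {x | hist n x = w} := by
  have : {x : ℤ → S | hist n x = w} = ⋂ i : Fin n, {x | XX (i : ℕ) x = w i} := by
    ext x; simp [hist, funext_iff]
  rw [this]
  refine MeasurableSet.iInter fun i => ?_
  exact meas_XX (fun k => |k| < (n:ℤ)) i (by simp) (by simp) _

lemma meas_XX' (n : ℕ) (s : S × S) : MeasurableSet {x : ℤ → S | XX n x = s} := by
  have : {x : ℤ → S | XX n x = s} = {x | x (-(n:ℤ)) = s.1} ∩ {x | x (n:ℤ) = s.2} := by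
    ext x; simp [XX, Prod.ext_iff]
  rw [this]
  exact ((measurable_pi_apply _) (measurableSet_singleton _)).inter
    ((measurable_pi_apply _) (measurableSet_singleton _))

lemma meas_hist' (n : ℕ) (w : Fin n → S × S) : MeasurableSet {x : ℤ → S | hist n x = w} := by
  have : {x : ℤ → S | hist n x = w} = ⋂ i : Fin n, {x | XX (i : ℕ) x = w i} := by
    ext x; simp [hist, funext_iff]
  rw [this]
  exact MeasurableSet.iInter fun i => meas_XX' _ _

lemma pmass_step (ν : Measure (ℤ → S)) [IsProbabilityMeasure ν] (hMF : IsMarkovField ν)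
    (P : ℕ → (S × S) → (S × S) → ℝ) (hPnn : ∀ n s t, 0 ≤ P n s t)
    (hP : ∀ (n : ℕ) (s t : S × S),
      ν {x | XX n x = s ∧ XX (n + 1) x = t} = ENNReal.ofReal (P n s t) * ν {x | XX n x = s})
    (n : ℕ) (hn : 1 ≤ n) (w : Fin n → S × S) (s t : S × S) (h0 : ν {x | XX n x = s} ≠ 0) :
    pmass ν (n + 1) (Fin.snoc (α := fun _ => S × S) w s) t = pmass ν n w s * P n s t := by
  have h := hMF n (by exact_mod_cast hn) {x | hist n x = w} {x | XX (n + 1) x = t}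
    (meas_hist n w) (meas_XX (fun k => (n:ℤ) < |k|) (n + 1)
      (by push_cast; rw [abs_of_nonneg (by positivity)]; omega)
      (by push_cast; rw [abs_neg, abs_of_nonneg (by positivity)]; omega) t) s
  have e1 : {x : ℤ → S | (x (-(n:ℤ)), x n) = s} = {x | XX n x = s} := rfl
  rw [e1] at h
  have e2 : {x : ℤ → S | XX (n + 1) x = t} ∩ {x | XX n x = s}
      = {x | XX n x = s ∧ XX (n + 1) x = t} := by ext; simp [and_comm]
  rw [e2, hP, ← mul_assoc] at h
  have h' := (ENNReal.mul_left_inj h0 (measure_ne_top _ _)).1 h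
  have e3 : {x : ℤ → S | hist (n + 1) x = Fin.snoc (α := fun _ => S × S) w s ∧ XX (n + 1) x = t}
      = {x | hist n x = w} ∩ {x | XX (n + 1) x = t} ∩ {x | XX n x = s} := by
    ext x
    simp only [hist_snoc, mem_ofPred_eq, mem_inter_iff]
    tauto
  unfold pmass Measure.real
  rw [e3, h', ENNReal.toReal_mul, ENNReal.toReal_ofReal (hPnn _ _ _)]
  rfl

lemma row_sum (ν : Measure (ℤ → S)) [IsProbabilityMeasure ν]
    (P : ℕ → (S × S) → (S × S) → ℝ) (hPnn : ∀ n s t, 0 ≤ P n s t)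
    (hP : ∀ (n : ℕ) (s t : S × S),
      ν {x | XX n x = s ∧ XX (n + 1) x = t} = ENNReal.ofReal (P n s t) * ν {x | XX n x = s})
    (n : ℕ) (s : S × S) (h0 : ν {x | XX n x = s} ≠ 0) : ∑ t, P n s t = 1 := by
  have e : {x : ℤ → S | XX n x = s} = ⋃ t, {x | XX n x = s ∧ XX (n + 1) x = t} := by
    ext x; simp
  have h1 : ν {x | XX n x = s} = ∑ t, ν {x | XX n x = s ∧ XX (n + 1) x = t} := by
    conv_lhs => rw [e]
    rw [measure_iUnion, tsum_fintype]
    · intro t t' htt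
      refine Set.disjoint_left.2 ?_
      rintro x ⟨_, h⟩ ⟨_, h'⟩
      exact htt (h.symm.trans h')
    · intro t
      exact (meas_XX' n s).inter (meas_XX' (n+1) t)
  simp_rw [hP] at h1
  rw [← Finset.sum_mul, ← ENNReal.ofReal_sum_of_nonneg (fun t _ => hPnn _ _ _)] at h1
  have h2 : ENNReal.ofReal (∑ t, P n s t) * ν {x | XX n x = s} = 1 * ν {x | XX n x = s} := by
    rw [one_mul]; exact h1.symm
  have h3 := (ENNReal.mul_left_inj h0 (measure_ne_top _ _)).1 h2
  simpa using h3

lemma Hell_step (ν μ : Measure (ℤ → S)) [IsProbabilityMeasure ν] [IsProbabilityMeasure μ]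
    (hMFν : IsMarkovField ν) (hMFμ : IsMarkovField μ)
    (P Q : ℕ → (S × S) → (S × S) → ℝ)
    (hPnn : ∀ n s t, 0 ≤ P n s t) (hQnn : ∀ n s t, 0 ≤ Q n s t)
    (hP : ∀ (n : ℕ) (s t : S × S),
      ν {x | XX n x = s ∧ XX (n + 1) x = t} = ENNReal.ofReal (P n s t) * ν {x | XX n x = s})
    (hQ : ∀ (n : ℕ) (s t : S × S),
      μ {x | XX n x = s ∧ XX (n + 1) x = t} = ENNReal.ofReal (Q n s t) * μ {x | XX n x = s})
    (n : ℕ) (hn : 1 ≤ n) (hν : ∀ s, ν {x | XX n x = s} ≠ 0) (hμ : ∀ s, μ {x | XX n x = s} ≠ 0)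
    (t : S × S) :
    Hell ν μ (n + 1) t = ∑ s, Hell ν μ n s * (Real.sqrt (P n s t) * Real.sqrt (Q n s t)) := by
  unfold Hell
  rw [← (Fin.snocEquiv (fun _ : Fin (n+1) => S × S)).sum_comp, Fintype.sum_prod_type]
  refine Finset.sum_congr rfl fun s _ => ?_
  rw [Finset.sum_mul]
  refine Finset.sum_congr rfl fun w _ => ?_
  have a1 := pmass_step ν hMFν P hPnn hP n hn w s t (hν s)
  have a2 := pmass_step μ hMFμ Q hQnn hQ n hn w s t (hμ s)
  change Real.sqrt (pmass ν (n + 1) (Fin.snoc (α := fun _ => S × S) w s) t) *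
    Real.sqrt (pmass μ (n + 1) (Fin.snoc (α := fun _ => S × S) w s) t) = _
  rw [a1, a2, Real.sqrt_mul (by unfold pmass; positivity), Real.sqrt_mul (by unfold pmass; positivity)]
  ring

lemma Hell_total (ν μ : Measure (ℤ → S)) [IsProbabilityMeasure ν] [IsProbabilityMeasure μ]
    (hMFν : IsMarkovField ν) (hMFμ : IsMarkovField μ)
    (P Q : ℕ → (S × S) → (S × S) → ℝ)
    (hPnn : ∀ n s t, 0 ≤ P n s t) (hQnn : ∀ n s t, 0 ≤ Q n s t)
    (hP : ∀ (n : ℕ) (s t : S × S),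
      ν {x | XX n x = s ∧ XX (n + 1) x = t} = ENNReal.ofReal (P n s t) * ν {x | XX n x = s})
    (hQ : ∀ (n : ℕ) (s t : S × S),
      μ {x | XX n x = s ∧ XX (n + 1) x = t} = ENNReal.ofReal (Q n s t) * μ {x | XX n x = s})
    (n : ℕ) (hn : 1 ≤ n) (hν : ∀ s, ν {x | XX n x = s} ≠ 0) (hμ : ∀ s, μ {x | XX n x = s} ≠ 0) :
    ∑ t, Hell ν μ (n + 1) t = ∑ s, Hell ν μ n s -
      ∑ s, Hell ν μ n s * ((∑ t, (Real.sqrt (P n s t) - Real.sqrt (Q n s t)) ^ 2) / 2) := by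
  simp_rw [Hell_step ν μ hMFν hMFμ P Q hPnn hQnn hP hQ n hn hν hμ]
  rw [Finset.sum_comm, ← Finset.sum_sub_distrib]
  refine Finset.sum_congr rfl fun s _ => ?_
  have h : ∑ t, (Real.sqrt (P n s t) - Real.sqrt (Q n s t)) ^ 2
      = 2 - 2 * ∑ t, Real.sqrt (P n s t) * Real.sqrt (Q n s t) := by
    have : ∀ t, (Real.sqrt (P n s t) - Real.sqrt (Q n s t)) ^ 2
        = P n s t + Q n s t - 2 * (Real.sqrt (P n s t) * Real.sqrt (Q n s t)) := by
      intro t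
      nlinarith [Real.sq_sqrt (hPnn n s t), Real.sq_sqrt (hQnn n s t)]
    simp_rw [this]
    rw [Finset.sum_sub_distrib, Finset.sum_add_distrib, row_sum ν P hPnn hP n s (hν s),
      row_sum μ Q hQnn hQ n s (hμ s), Finset.mul_sum]
    norm_num
  rw [h, ← Finset.mul_sum]
  ring

lemma Hell_nonneg (ν μ : Measure (ℤ → S)) (n : ℕ) (s : S × S) : 0 ≤ Hell ν μ n s := by
  unfold Hell; positivity

lemma cs_set {Ω : Type*} [MeasurableSpace Ω] (μ : Measure Ω) (Z : Ω → ENNReal) (hZ : Measurable Z)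
    (A : Set Ω) :
    ∫⁻ x in A, Z x ^ (1/2 : ℝ) ∂μ ≤ (∫⁻ x in A, Z x ∂μ) ^ (1/2 : ℝ) * (μ A) ^ (1/2 : ℝ) := by
  have h := ENNReal.lintegral_mul_le_Lp_mul_Lq (μ.restrict A) Real.HolderConjugate.two_two
    (f := fun x => Z x ^ (1/2 : ℝ)) (g := fun _ => 1) (by fun_prop) (by fun_prop)
  have e : ∀ x, (Z x ^ (1/2 : ℝ)) ^ (2 : ℝ) = Z x := fun x => by
    rw [← ENNReal.rpow_mul]; norm_num
  simp only [e] at h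
  simpa using h

lemma Hell_lower (ν μ : Measure (ℤ → S)) [IsProbabilityMeasure ν] [IsProbabilityMeasure μ]
    (hac : ν ≪ μ) (n : ℕ) (s : S × S) :
    ∫⁻ x in {x | XX n x = s}, (ν.rnDeriv μ x) ^ (1/2 : ℝ) ∂μ ≤ ENNReal.ofReal (Hell ν μ n s) := by
  have e : {x : ℤ → S | XX n x = s} = ⋃ w, {x | hist n x = w ∧ XX n x = s} := by
    ext x; simp
  rw [e, lintegral_iUnion]
  rotate_left
  · intro w
    exact (meas_hist' n w).inter (meas_XX' n s)
  · intro t t' htt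
    refine Set.disjoint_left.2 ?_
    rintro x ⟨h, _⟩ ⟨h', _⟩
    exact htt (h.symm.trans h')
  rw [tsum_fintype]
  unfold Hell
  rw [ENNReal.ofReal_sum_of_nonneg (fun _ _ => by positivity)]
  refine Finset.sum_le_sum fun w _ => ?_
  refine (cs_set μ _ (Measure.measurable_rnDeriv ν μ) _).trans ?_
  rw [Measure.setLIntegral_rnDeriv hac]
  unfold pmass Measure.real
  rw [ENNReal.ofReal_mul (Real.sqrt_nonneg _), Real.sqrt_eq_rpow, Real.sqrt_eq_rpow,
    ← ENNReal.ofReal_rpow_of_nonneg ENNReal.toReal_nonneg (by norm_num),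
    ← ENNReal.ofReal_rpow_of_nonneg ENNReal.toReal_nonneg (by norm_num),
    ENNReal.ofReal_toReal (measure_ne_top _ _), ENNReal.ofReal_toReal (measure_ne_top _ _)]

lemma delta_exists {Ω : Type*} [MeasurableSpace Ω] (ν μ : Measure Ω)
    [IsProbabilityMeasure ν] [IsProbabilityMeasure μ] (hac : ν ≪ μ) (c : ENNReal) (hc : c ≠ 0) :
    ∃ δ > 0, ∀ A, MeasurableSet A → c ≤ ν A →
      δ ≤ ∫⁻ x in A, (ν.rnDeriv μ x) ^ (1/2 : ℝ) ∂μ := by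
  have hm : Measurable (fun x => (ν.rnDeriv μ x) ^ (1/2 : ℝ)) := by
    have := Measure.measurable_rnDeriv ν μ
    fun_prop
  have key : ∀ A, MeasurableSet A → ∫⁻ x in A, (ν.rnDeriv μ x) ^ (1/2 : ℝ)
      ∂(μ.withDensity (fun x => (ν.rnDeriv μ x) ^ (1/2 : ℝ))) = ν A := by
    intro A hA
    rw [setLIntegral_withDensity_eq_setLIntegral_mul _ hm hm hA, ← Measure.setLIntegral_rnDeriv hac]
    refine lintegral_congr fun x => ?_
    simp only [Pi.mul_apply]
    rw [← ENNReal.rpow_add_of_nonneg _ _ (by norm_num) (by norm_num)]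
    norm_num
  obtain ⟨δ, hδ, h⟩ := exists_pos_setLIntegral_lt_of_measure_lt
    (μ := μ.withDensity (fun x => (ν.rnDeriv μ x) ^ (1/2 : ℝ)))
    (f := fun x => (ν.rnDeriv μ x) ^ (1/2 : ℝ))
    (by rw [← setLIntegral_univ, key _ MeasurableSet.univ]; simp) hc
  refine ⟨δ, hδ, fun A hA hcA => ?_⟩
  by_contra hlt
  push Not at hlt
  have := h A (by rwa [withDensity_apply _ hA])
  rw [key A hA] at this
  exact absurd hcA (not_le.2 this)

/-- Theorem A (necessity direction): if `ν ∈ ℛ` is a Markov field locally absolutely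
continuous with respect to the Markov field `μ`, and `ν ≪ μ`, then
`∑_n D_n²(ν,μ) = ∑_n ∑_{s,t} (√(P_n(s,t)) - √(Q_n(s,t)))² < ∞`. -/
theorem stmt18 (ν μ : Measure (ℤ → S))
    [IsProbabilityMeasure ν] [IsProbabilityMeasure μ]
    (hMFν : IsMarkovField ν) (hMFμ : IsMarkovField μ)
    (P Q : ℕ → (S × S) → (S × S) → ℝ)
    (hPnn : ∀ n s t, 0 ≤ P n s t) (hQnn : ∀ n s t, 0 ≤ Q n s t)
    (hP : ∀ (n : ℕ) (s t : S × S),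
      ν {x | XX n x = s ∧ XX (n + 1) x = t} = ENNReal.ofReal (P n s t) * ν {x | XX n x = s})
    (hQ : ∀ (n : ℕ) (s t : S × S),
      μ {x | XX n x = s ∧ XX (n + 1) x = t} = ENNReal.ofReal (Q n s t) * μ {x | XX n x = s})
    (hR : classR ν)
    (hloc : ∀ n : ℕ, ∀ E : Set (ℤ → S), MeasurableSet[Acal S n] E → μ E = 0 → ν E = 0)
    (hac : ν ≪ μ) :
    Summable (fun n : ℕ => ∑ s : S × S, ∑ t : S × S,
      (Real.sqrt (P n s t) - Real.sqrt (Q n s t)) ^ 2) := by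
  have hc : ∀ s : S × S, ∃ c : ENNReal, 0 < c ∧
      ∀ᶠ n in atTop, c < ν {x | XX n x = s} := by
    intro s
    obtain ⟨c, hc0, hc⟩ := exists_between (hR s)
    exact ⟨c, hc0, eventually_lt_of_lt_liminf hc⟩
  choose c hc0 hc using hc
  obtain ⟨N, hN⟩ := eventually_atTop.1 ((eventually_all.2 hc).and (eventually_ge_atTop 1))
  have hν : ∀ n, N ≤ n → ∀ s, ν {x | XX n x = s} ≠ 0 := fun n hn s =>
    (lt_of_le_of_lt zero_le ((hN n hn).1 s)).ne'
  have hμ : ∀ n, N ≤ n → ∀ s, μ {x | XX n x = s} ≠ 0 := fun n hn s h =>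
    hν n hn s (hac h)
  refine summable_sum fun s _ => ?_
  rw [← summable_nat_add_iff N]
  obtain ⟨δ, hδ, hlow⟩ := delta_exists ν μ hac (c s) (hc0 s).ne'
  have hH : ∀ n, N ≤ n → δ ≤ ENNReal.ofReal (Hell ν μ n s) := fun n hn =>
    (hlow _ (meas_XX' n s) ((hN n hn).1 s).le).trans (Hell_lower ν μ hac n s)
  have hδt : δ ≠ ⊤ := ne_top_of_le_ne_top ENNReal.ofReal_ne_top (hH N le_rfl)
  have hd : 0 < δ.toReal := ENNReal.toReal_pos hδ.ne' hδt
  have hH' : ∀ n, N ≤ n → δ.toReal ≤ Hell ν μ n s := fun n hn =>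
    (ENNReal.le_ofReal_iff_toReal_le hδt (Hell_nonneg ν μ n s)).1 (hH n hn)
  have hstep : ∀ n, N ≤ n →
      δ.toReal / 2 * (∑ t, (Real.sqrt (P n s t) - Real.sqrt (Q n s t)) ^ 2) ≤
      ∑ t, Hell ν μ n t - ∑ t, Hell ν μ (n + 1) t := by
    intro n hn
    rw [Hell_total ν μ hMFν hMFμ P Q hPnn hQnn hP hQ n (hN n hn).2 (hν n hn) (hμ n hn)]
    rw [sub_sub_cancel]
    have h1 := Finset.single_le_sum (f := fun s => Hell ν μ n s *
      ((∑ t, (Real.sqrt (P n s t) - Real.sqrt (Q n s t)) ^ 2) / 2))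
      (fun i _ => mul_nonneg (Hell_nonneg ν μ n i) (by positivity)) (Finset.mem_univ s)
    refine le_trans ?_ h1
    have h2 : 0 ≤ (∑ t, (Real.sqrt (P n s t) - Real.sqrt (Q n s t)) ^ 2) / 2 := by positivity
    have := mul_le_mul_of_nonneg_right (hH' n hn) h2
    linarith
  have hsum : Summable (fun k : ℕ => δ.toReal / 2 *
      (∑ t, (Real.sqrt (P (k + N) s t) - Real.sqrt (Q (k + N) s t)) ^ 2)) := by
    refine summable_of_sum_range_le (c := ∑ t, Hell ν μ N t) (fun k => by positivity) fun m => ?_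
    have h1 : ∀ m : ℕ, ∑ k ∈ Finset.range m, δ.toReal / 2 *
      (∑ t, (Real.sqrt (P (k + N) s t) - Real.sqrt (Q (k + N) s t)) ^ 2) ≤
      ∑ t, Hell ν μ N t - ∑ t, Hell ν μ (m + N) t := by
      intro m
      induction m with
      | zero => simp
      | succ m ih =>
        rw [Finset.sum_range_succ]
        have := hstep (m + N) (by omega)
        rw [show m + 1 + N = m + N + 1 by omega]
        linarith
    have h2 : 0 ≤ ∑ t, Hell ν μ (m + N) t := Finset.sum_nonneg fun t _ => Hell_nonneg ν μ _ t
    linarith [h1 m]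
  exact (summable_mul_left_iff (by positivity)).1 hsum
end
end

section
/- Let $\nu,\mu$ be Markov fields on $\mathcal{S}^{\mathbb{I}}$ in class $\mathscr{S}$ with $\nu\overset{loc}{\sim}\mu$. Then either $\nu \sim \mu$ or $\nu \perp \mu$, and moreover $\nu\sim\mu$ if and only if $\sum_{n\geq 1} D_n^2(\nu,\mu) < \infty$, where $D_n^2(\nu,\mu)=\sum_{s,t\in\mathbb{S}}(\sqrt{P_n(s,t)}-\sqrt{Q_n(s,t)})^2$. -/
open MeasureTheory ProbabilityTheory Filter Set

noncomputable section

variable {S : Type*} [Fintype S] [MeasurableSpace S] [MeasurableSingletonClass S]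

section Comb
variable {T : Type*} [Fintype T]

/-- one step operator -/
def opA (A : ℕ → T → T → ℝ) (n : ℕ) (g : T → ℝ) (s : T) : ℝ := ∑ t, A n s t * g t

/-- iterated operator from time n to n+j -/
def opK (A : ℕ → T → T → ℝ) (n : ℕ) : ℕ → (T → ℝ) → T → ℝ
  | 0, g => g
  | j + 1, g => opK A n j (opA A (n + j) g)

/-- geometric mean kernel -/
def gm (P Q : ℕ → T → T → ℝ) (n : ℕ) (s t : T) : ℝ := √(P n s t) * √(Q n s t)

lemma opA_mono {A : ℕ → T → T → ℝ} (hA : ∀ n s t, 0 ≤ A n s t) (n : ℕ) {f g : T → ℝ}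
    (h : ∀ t, f t ≤ g t) (s : T) : opA A n f s ≤ opA A n g s :=
  Finset.sum_le_sum fun t _ => mul_le_mul_of_nonneg_left (h t) (hA n s t)

lemma opK_mono {A : ℕ → T → T → ℝ} (hA : ∀ n s t, 0 ≤ A n s t) (n j : ℕ) {f g : T → ℝ}
    (h : ∀ t, f t ≤ g t) (s : T) : opK A n j f s ≤ opK A n j g s := by
  induction j generalizing f g with
  | zero => exact h s
  | succ j ih => exact ih (fun t => opA_mono hA _ h t)

lemma opK_lin (A : ℕ → T → T → ℝ) (n j : ℕ) (f g : T → ℝ) (a b : ℝ) (s : T) :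
    opK A n j (fun t => a * f t + b * g t) s = a * opK A n j f s + b * opK A n j g s := by
  induction j generalizing f g with
  | zero => rfl
  | succ j ih =>
    simp only [opK]
    rw [← ih]
    congr 1
    ext t
    simp only [opA, Finset.mul_sum, ← Finset.sum_add_distrib]
    exact Finset.sum_congr rfl fun _ _ => by ring

lemma opK_smul (A : ℕ → T → T → ℝ) (n j : ℕ) (f : T → ℝ) (a : ℝ) (s : T) :
    opK A n j (fun t => a * f t) s = a * opK A n j f s := by
  simpa using opK_lin A n j f f a 0 s

lemma opA_zero (A : ℕ → T → T → ℝ) (n : ℕ) : opA A n (fun _ => 0) = fun _ => 0 := by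
  ext; simp [opA]

lemma opK_nonneg {A : ℕ → T → T → ℝ} (hA : ∀ n s t, 0 ≤ A n s t) (n j : ℕ) {g : T → ℝ}
    (h : ∀ t, 0 ≤ g t) (s : T) : 0 ≤ opK A n j g s := by
  have := opK_mono hA n j (f := fun t => 0 * g t) (g := g) (by simpa using h) s
  rw [opK_smul] at this
  simpa using this

lemma opK_add (A : ℕ → T → T → ℝ) (n i j : ℕ) (g : T → ℝ) :
    opK A n (i + j) g = opK A n i (opK A (n + i) j g) := by
  induction j generalizing g with
  | zero => rfl
  | succ j ih =>
    rw [← add_assoc]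
    simp only [opK]
    rw [ih, add_assoc]

lemma opK_one {A : ℕ → T → T → ℝ} {n0 : ℕ} (h1 : ∀ n, n0 ≤ n → ∀ s, ∑ t, A n s t = 1)
    (n j : ℕ) (hn : n0 ≤ n) : opK A n j (fun _ => 1) = fun _ => 1 := by
  induction j with
  | zero => rfl
  | succ j ih =>
    simp only [opK]
    have : opA A (n + j) (fun _ => 1) = fun _ => 1 := by
      ext s; simp [opA, h1 (n + j) (by omega)]
    rw [this, ih]

lemma gm_nonneg (P Q : ℕ → T → T → ℝ) (n : ℕ) (s t : T) : 0 ≤ gm P Q n s t := by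
  unfold gm; positivity

/-- row Hellinger distance -/
def dd (P Q : ℕ → T → T → ℝ) (n : ℕ) (s : T) : ℝ := ∑ t, (√(P n s t) - √(Q n s t)) ^ 2

lemma dd_nonneg (P Q : ℕ → T → T → ℝ) (n : ℕ) (s : T) : 0 ≤ dd P Q n s :=
  Finset.sum_nonneg fun _ _ => sq_nonneg _

lemma gm_one {P Q : ℕ → T → T → ℝ} (hP : ∀ n s t, 0 ≤ P n s t) (hQ : ∀ n s t, 0 ≤ Q n s t)
    (n : ℕ) (s : T) (hP1 : ∑ t, P n s t = 1) (hQ1 : ∑ t, Q n s t = 1) :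
    opA (gm P Q) n (fun _ => 1) s = 1 - dd P Q n s / 2 := by
  have : dd P Q n s = ∑ t, (P n s t + Q n s t - 2 * gm P Q n s t) := by
    refine Finset.sum_congr rfl fun t _ => ?_
    unfold gm
    have := Real.sq_sqrt (hP n s t)
    have := Real.sq_sqrt (hQ n s t)
    ring_nf
    linarith
  rw [this, Finset.sum_sub_distrib, Finset.sum_add_distrib, hP1, hQ1, ← Finset.mul_sum]
  simp only [opA, mul_one]
  ring

lemma opA_gm_le {P Q : ℕ → T → T → ℝ} (hP : ∀ n s t, 0 ≤ P n s t) (hQ : ∀ n s t, 0 ≤ Q n s t)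
    (n : ℕ) (f g : T → ℝ) (hf : ∀ t, 0 ≤ f t) (hg : ∀ t, 0 ≤ g t) (s : T) :
    opA (gm P Q) n (fun t => √(f t) * √(g t)) s ≤ √(opA P n f s) * √(opA Q n g s) := by
  unfold opA
  refine le_trans (le_of_eq ?_) (Real.sum_sqrt_mul_sqrt_le _
    (fun t => mul_nonneg (hP n s t) (hf t)) (fun t => mul_nonneg (hQ n s t) (hg t)))
  refine Finset.sum_congr rfl fun t _ => ?_
  rw [Real.sqrt_mul (hP n s t), Real.sqrt_mul (hQ n s t), gm]
  ring

lemma opK_gm_le {P Q : ℕ → T → T → ℝ} (hP : ∀ n s t, 0 ≤ P n s t) (hQ : ∀ n s t, 0 ≤ Q n s t)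
    (n j : ℕ) (f g : T → ℝ) (hf : ∀ t, 0 ≤ f t) (hg : ∀ t, 0 ≤ g t) (s : T) :
    opK (gm P Q) n j (fun t => √(f t) * √(g t)) s ≤ √(opK P n j f s) * √(opK Q n j g s) := by
  induction j generalizing f g with
  | zero => exact le_rfl
  | succ j ih =>
    refine le_trans (opK_mono (gm_nonneg P Q) n j (opA_gm_le hP hQ (n + j) f g hf hg) s) ?_
    exact ih _ _ (fun t => Finset.sum_nonneg fun u _ => mul_nonneg (hP _ _ _) (hf u))
      (fun t => Finset.sum_nonneg fun u _ => mul_nonneg (hQ _ _ _) (hg u))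

lemma opK_gm_le_half {P Q : ℕ → T → T → ℝ} (hP : ∀ n s t, 0 ≤ P n s t)
    (hQ : ∀ n s t, 0 ≤ Q n s t) (n j : ℕ) (f : T → ℝ) (hf : ∀ t, 0 ≤ f t) (s : T) :
    opK (gm P Q) n j f s ≤ (opK P n j f s + opK Q n j f s) / 2 := by
  have h := opK_gm_le hP hQ n j f f hf hf s
  have e : (fun t => √(f t) * √(f t)) = f := by ext t; exact Real.mul_self_sqrt (hf t)
  rw [e] at h
  have h1 := Real.sq_sqrt (opK_nonneg hP n j hf s)
  have h2 := Real.sq_sqrt (opK_nonneg hQ n j hf s)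
  nlinarith [sq_nonneg (√(opK P n j f s) - √(opK Q n j f s))]

/-- lower bound for mass -/
lemma opK_gm_ge {P Q : ℕ → T → T → ℝ} (hP : ∀ n s t, 0 ≤ P n s t)
    (hQ : ∀ n s t, 0 ≤ Q n s t) {n0 : ℕ}
    (hP1 : ∀ n, n0 ≤ n → ∀ s, ∑ t, P n s t = 1) (hQ1 : ∀ n, n0 ≤ n → ∀ s, ∑ t, Q n s t = 1)
    (n j : ℕ) (hn : n0 ≤ n) (f : T → ℝ) (hf : ∀ t, 0 ≤ f t) (hf1 : ∀ t, f t ≤ 1) (s : T) :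
    opK (gm P Q) n j (fun _ => 1) s - 1 + opK P n j f s / 2 ≤ opK (gm P Q) n j f s := by
  have h := opK_gm_le_half hP hQ n j (fun t => 1 * 1 + (-1) * f t)
    (fun t => by linarith [hf1 t]) s
  rw [opK_lin _ n j (fun _ => 1) f, opK_lin _ n j (fun _ => 1) f,
    opK_lin _ n j (fun _ => 1) f, opK_one hP1 n j hn, opK_one hQ1 n j hn] at h
  have := opK_nonneg hQ n j hf s
  linarith

lemma opK_gm_anti {P Q : ℕ → T → T → ℝ} (hP : ∀ n s t, 0 ≤ P n s t)
    (hQ : ∀ n s t, 0 ≤ Q n s t) {n0 : ℕ}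
    (hP1 : ∀ n, n0 ≤ n → ∀ s, ∑ t, P n s t = 1) (hQ1 : ∀ n, n0 ≤ n → ∀ s, ∑ t, Q n s t = 1)
    (n : ℕ) (hn : n0 ≤ n) (s : T) :
    Antitone fun j => opK (gm P Q) n j (fun _ => 1) s := by
  refine antitone_nat_of_succ_le fun j => ?_
  refine opK_mono (gm_nonneg P Q) n j (fun t => ?_) s
  rw [gm_one hP hQ _ _ (hP1 _ (by omega) t) (hQ1 _ (by omega) t)]
  linarith [dd_nonneg P Q (n + j) t]

/-- Key: if the affinity does not vanish then the Hellinger sum converges. -/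
lemma key_summable [DecidableEq T] {P Q : ℕ → T → T → ℝ} (hP : ∀ n s t, 0 ≤ P n s t)
    (hQ : ∀ n s t, 0 ≤ Q n s t) {n0 : ℕ}
    (hP1 : ∀ n, n0 ≤ n → ∀ s, ∑ t, P n s t = 1) (hQ1 : ∀ n, n0 ≤ n → ∀ s, ∑ t, Q n s t = 1)
    {c : ℝ} (hc : 0 < c) {N : ℕ}
    (hmix : ∀ n, n0 ≤ n → ∀ j, N ≤ j → ∀ s t, c ≤ opK P n j (fun u => if u = t then 1 else 0) s)
    (n : ℕ) (hn : n0 ≤ n) (s : T)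
    (h : ¬ Tendsto (fun j => opK (gm P Q) n j (fun _ => 1) s) atTop (nhds 0)) :
    Summable fun k => ∑ u, dd P Q k u := by
  have hbdd : ∀ n s, BddBelow (range fun j => opK (gm P Q) n j (fun _ => 1) s) := fun n s =>
    ⟨0, by rintro _ ⟨j, rfl⟩; exact opK_nonneg (gm_nonneg P Q) n j (fun _ => zero_le_one) s⟩
  set r : ℕ → T → ℝ := fun n s => ⨅ j, opK (gm P Q) n j (fun _ => 1) s with hr
  have hlim : ∀ n, n0 ≤ n → ∀ s,
      Tendsto (fun j => opK (gm P Q) n j (fun _ => 1) s) atTop (nhds (r n s)) := fun n hn s =>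
    tendsto_atTop_ciInf (opK_gm_anti hP hQ hP1 hQ1 n hn s) (hbdd n s)
  have hrle : ∀ n s j, r n s ≤ opK (gm P Q) n j (fun _ => 1) s := fun n s j => ciInf_le (hbdd n s) j
  have hr0 : ∀ n s, 0 ≤ r n s := fun n s =>
    le_ciInf fun j => opK_nonneg (gm_nonneg P Q) n j (fun _ => zero_le_one) s
  have hpos : 0 < r n s := by
    refine lt_of_le_of_ne (hr0 n s) fun h0 => h ?_
    rw [h0]; exact hlim n hn s
  -- continuity of opK in the function
  have hcont : ∀ (A : ℕ → T → T → ℝ) (n i : ℕ) (F : ℕ → T → ℝ) (G : T → ℝ),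
      (∀ t, Tendsto (fun j => F j t) atTop (nhds (G t))) → ∀ s,
      Tendsto (fun j => opK A n i (F j) s) atTop (nhds (opK A n i G s)) := by
    intro A n i
    induction i with
    | zero => intro F G hF s; exact hF s
    | succ i ih =>
      intro F G hF s
      refine ih (fun j => opA A (n + i) (F j)) (opA A (n + i) G) (fun t => ?_) s
      exact tendsto_finsetSum _ fun u _ => (hF u).const_mul _
  -- sup of r is at least one
  have hex : ∃ n', n0 ≤ n' ∧ ∃ s', 1 - c / 4 < r n' s' := by
    by_contra hcon
    push Not at hcon
    set m := 1 - c / 4 with hm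
    have h1 : ∀ i, r n s ≤ m * opK (gm P Q) n i (fun _ => 1) s := by
      intro i
      have h2 : Tendsto (fun j => opK (gm P Q) n i (opK (gm P Q) (n + i) j (fun _ => 1)) s) atTop
          (nhds (opK (gm P Q) n i (r (n + i)) s)) :=
        hcont _ _ _ _ _ (fun t => hlim (n + i) (by omega) t) s
      have h3 : r n s ≤ opK (gm P Q) n i (r (n + i)) s := by
        refine ge_of_tendsto' h2 fun j => ?_
        rw [← opK_add]; exact hrle _ _ _
      refine h3.trans ?_
      rw [← opK_smul]
      exact opK_mono (gm_nonneg P Q) n i (fun t => by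
        simpa using hcon (n + i) (by omega) t) s
    have h4 : r n s ≤ m * r n s := ge_of_tendsto' ((hlim n hn s).const_mul m) h1
    nlinarith
  obtain ⟨n', hn', s', hs'⟩ := hex
  have hlow : ∀ j, N ≤ j → ∀ u, c / 4 ≤ opK (gm P Q) n' j (fun v => if v = u then 1 else 0) s' := by
    intro j hj u
    have h1 := opK_gm_ge hP hQ hP1 hQ1 n' j hn' (fun v => if v = u then 1 else 0)
      (fun t => by positivity) (fun t => by split_ifs <;> norm_num) s'
    have h2 := hmix n' hn' j hj s' u
    have h3 := hrle n' s' j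
    linarith
  have hstep : ∀ j, N ≤ j → ∀ u, opK (gm P Q) n' (j + 1) (fun _ => 1) s' ≤
      opK (gm P Q) n' j (fun _ => 1) s' - c / 8 * dd P Q (n' + j) u := by
    intro j hj u
    have h1 : opK (gm P Q) n' (j + 1) (fun _ => 1) s' ≤ opK (gm P Q) n' j
        (fun t => 1 * 1 + (- (dd P Q (n' + j) u / 2)) * (if t = u then 1 else 0)) s' := by
      refine opK_mono (gm_nonneg P Q) n' j (fun t => ?_) s'
      rw [gm_one hP hQ _ _ (hP1 _ (by omega) t) (hQ1 _ (by omega) t)]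
      split_ifs with htu
      · subst htu; linarith
      · linarith [dd_nonneg P Q (n' + j) t]
    rw [opK_lin _ n' j (fun _ => 1) (fun t => if t = u then 1 else 0)] at h1
    have := hlow j hj u
    nlinarith [dd_nonneg P Q (n' + j) u]
  refine summable_sum fun u _ => ?_
  rw [← summable_nat_add_iff (n' + N)]
  refine summable_of_sum_range_le (c := 8 / c) (fun k => dd_nonneg _ _ _ _) fun k => ?_
  have htel : ∀ k, c / 8 * ∑ i ∈ Finset.range k, dd P Q (i + (n' + N)) u ≤
      1 - opK (gm P Q) n' (N + k) (fun _ => 1) s' := by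
    intro k
    induction k with
    | zero =>
      have := opK_gm_anti hP hQ hP1 hQ1 n' hn' s' (Nat.zero_le N)
      simp only [opK] at this
      simp; linarith
    | succ k ih =>
      rw [Finset.sum_range_succ, mul_add]
      have := hstep (N + k) (by omega) u
      have e : k + (n' + N) = n' + (N + k) := by omega
      rw [e]
      rw [add_assoc] at this
      linarith
  have h1 := htel k
  have h2 := opK_nonneg (gm_nonneg P Q) n' (N + k) (fun _ => zero_le_one) s'
  rw [le_div_iff₀ hc]
  linarith

/-- Summable case: affinity uniformly close to one. -/
lemma key_close {P Q : ℕ → T → T → ℝ} (hP : ∀ n s t, 0 ≤ P n s t)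
    (hQ : ∀ n s t, 0 ≤ Q n s t) {n0 : ℕ}
    (hP1 : ∀ n, n0 ≤ n → ∀ s, ∑ t, P n s t = 1) (hQ1 : ∀ n, n0 ≤ n → ∀ s, ∑ t, Q n s t = 1)
    (hs : Summable fun k => ∑ u, dd P Q k u) {ε : ℝ} (hε : 0 < ε) :
    ∃ n, n0 ≤ n ∧ ∀ j s, 1 - ε ≤ opK (gm P Q) n j (fun _ => 1) s := by
  have h := tendsto_sum_nat_add (fun k => ∑ u, dd P Q k u)
  obtain ⟨n, hn, hn0⟩ := ((h.eventually (gt_mem_nhds hε)).and (eventually_ge_atTop n0)).exists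
  refine ⟨n, hn0, fun j s => ?_⟩
  have hD0 : ∀ k, 0 ≤ ∑ u, dd P Q k u := fun k => Finset.sum_nonneg fun u _ => dd_nonneg _ _ _ _
  have hb : 1 - ∑ i ∈ Finset.range j, ∑ u, dd P Q (i + n) u ≤
      opK (gm P Q) n j (fun _ => 1) s := by
    induction j with
    | zero => simp [opK]
    | succ j ih =>
      rw [Finset.sum_range_succ]
      set D := ∑ u, dd P Q (j + n) u with hD
      have h1 : opK (gm P Q) n j (fun t => (1 - D / 2) * 1) s ≤
          opK (gm P Q) n (j + 1) (fun _ => 1) s := by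
        refine opK_mono (gm_nonneg P Q) n j (fun t => ?_) s
        rw [gm_one hP hQ _ _ (hP1 _ (by omega) t) (hQ1 _ (by omega) t)]
        have : dd P Q (n + j) t ≤ D := by
          rw [hD, add_comm j n]
          exact Finset.single_le_sum (f := fun u => dd P Q (n + j) u)
            (fun u _ => dd_nonneg _ _ _ _) (Finset.mem_univ t)
        linarith
      rw [opK_smul] at h1
      have h2 := opK_gm_anti hP hQ hP1 hQ1 n hn0 s (Nat.zero_le j)
      simp only [opK] at h2
      have h3 : 0 ≤ D := hD0 _
      nlinarith
  have h4 : ∑ i ∈ Finset.range j, ∑ u, dd P Q (i + n) u ≤ ∑' k, ∑ u, dd P Q (k + n) u :=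
    Summable.sum_le_tsum _ (fun i _ => hD0 _) ((summable_nat_add_iff n).2 hs)
  linarith

end Comb

section Meas
variable {Ω T : Type*} [MeasurableSpace Ω] [Fintype T] [MeasurableSpace T]
  [MeasurableSingletonClass T]

/-- path up to time m -/
def ppi (Y : ℕ → Ω → T) (m : ℕ) (x : Ω) : Fin (m + 1) → T := fun i => Y i x

/-- atom probability -/
def atm (Y : ℕ → Ω → T) (α : Measure Ω) (m : ℕ) (w : Fin (m + 1) → T) : ℝ :=
  α.real (ppi Y m ⁻¹' {w})

/-- Markov property on paths with kernel `P` from time `n0` on -/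
def MP (Y : ℕ → Ω → T) (α : Measure Ω) (P : ℕ → T → T → ℝ) (n0 : ℕ) : Prop :=
  ∀ m, n0 ≤ m → ∀ (w : Fin (m + 1) → T) (t : T),
    α.real {x | ppi Y m x = w ∧ Y (m + 1) x = t} = atm Y α m w * P m (w (Fin.last m)) t

lemma ppi_snoc (Y : ℕ → Ω → T) (m : ℕ) (w : Fin (m + 1) → T) (t : T) :
    ppi Y (m + 1) ⁻¹' {(Fin.snoc w t : Fin (m + 1 + 1) → T)} =
      {x | ppi Y m x = w ∧ Y (m + 1) x = t} := by
  ext x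
  simp only [mem_preimage, mem_singleton_iff, mem_ofPred_eq, funext_iff, Fin.forall_fin_succ', ppi]
  simp

lemma atm_nonneg (Y : ℕ → Ω → T) (α : Measure Ω) (m : ℕ) (w : Fin (m + 1) → T) :
    0 ≤ atm Y α m w := measureReal_nonneg

lemma atm_snoc {Y : ℕ → Ω → T} {α : Measure Ω} {P : ℕ → T → T → ℝ} {n0 : ℕ}
    (h : MP Y α P n0) (m : ℕ) (hm : n0 ≤ m) (w : Fin (m + 1) → T) (t : T) :
    atm Y α (m + 1) (Fin.snoc w t : Fin (m + 1 + 1) → T) =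
      atm Y α m w * P m (w (Fin.last m)) t := by
  rw [← h m hm, ← ppi_snoc]; rfl

lemma sum_snoc (m : ℕ) (F : (Fin (m + 1 + 1) → T) → ℝ) :
    ∑ w, F w = ∑ w : Fin (m + 1) → T, ∑ t, F (Fin.snoc w t : Fin (m + 1 + 1) → T) := by
  rw [← (Fin.snocEquiv (fun _ : Fin (m + 1 + 1) => T)).sum_comp, Fintype.sum_prod_type,
    Finset.sum_comm]
  rfl

lemma aff_step {Y : ℕ → Ω → T} {α β : Measure Ω} {P Q : ℕ → T → T → ℝ} {n0 : ℕ}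
    (hα : MP Y α P n0) (hβ : MP Y β Q n0) (m : ℕ) (hm : n0 ≤ m) (g : T → ℝ) :
    ∑ w, √(atm Y α (m + 1) w) * √(atm Y β (m + 1) w) * g (w (Fin.last (m + 1))) =
    ∑ w, √(atm Y α m w) * √(atm Y β m w) * opA (gm P Q) m g (w (Fin.last m)) := by
  rw [sum_snoc]
  refine Finset.sum_congr rfl fun w _ => ?_
  rw [opA, Finset.mul_sum]
  refine Finset.sum_congr rfl fun t _ => ?_
  rw [atm_snoc hα m hm, atm_snoc hβ m hm, Real.sqrt_mul (atm_nonneg _ _ _ _),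
    Real.sqrt_mul (atm_nonneg _ _ _ _), Fin.snoc_last, gm]
  ring

lemma aff_formula {Y : ℕ → Ω → T} {α β : Measure Ω} {P Q : ℕ → T → T → ℝ} {n0 : ℕ}
    (hα : MP Y α P n0) (hβ : MP Y β Q n0) (n j : ℕ) (hn : n0 ≤ n) (g : T → ℝ) :
    ∑ w, √(atm Y α (n + j) w) * √(atm Y β (n + j) w) * g (w (Fin.last (n + j))) =
    ∑ w, √(atm Y α n w) * √(atm Y β n w) * opK (gm P Q) n j g (w (Fin.last n)) := by
  induction j generalizing g with
  | zero => rfl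
  | succ j ih =>
    rw [opK, ← ih]
    exact aff_step hα hβ (n + j) (by omega) g

lemma ppi_meas {Y : ℕ → Ω → T} (hY : ∀ n, Measurable (Y n)) (m : ℕ) : Measurable (ppi Y m) :=
  measurable_pi_lambda _ fun i => hY i

lemma real_cyl {Y : ℕ → Ω → T} (hY : ∀ n, Measurable (Y n)) (α : Measure Ω) [IsFiniteMeasure α]
    (m : ℕ) (E : Finset (Fin (m + 1) → T)) :
    α.real (ppi Y m ⁻¹' E) = ∑ w ∈ E, atm Y α m w := by
  unfold atm
  rw [sum_measureReal_preimage_singleton]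
  exact fun w _ => ppi_meas hY m (measurableSet_singleton w)

lemma sing_of_aff {Y : ℕ → Ω → T} (hY : ∀ n, Measurable (Y n)) (α β : Measure Ω)
    [IsFiniteMeasure α] [IsFiniteMeasure β] (n : ℕ)
    (h : Tendsto (fun j => ∑ w, √(atm Y α (n + j) w) * √(atm Y β (n + j) w)) atTop (nhds 0)) :
    α ⟂ₘ β := by
  classical
  apply Measure.mutuallySingular_of_disjoint
  rw [disjoint_iff_inf_le]
  set l := α ⊓ β with hl
  have hlα : l ≤ α := inf_le_left
  have hlβ : l ≤ β := inf_le_right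
  have : IsFiniteMeasure l := isFiniteMeasure_of_le α hlα
  have key : ∀ m, l.real univ ≤ 2 * ∑ w, √(atm Y α m w) * √(atm Y β m w) := by
    intro m
    have h1 : l.real univ = ∑ w, atm Y l m w := by
      rw [← real_cyl hY]; simp
    rw [h1, Finset.mul_sum]
    refine Finset.sum_le_sum fun w _ => ?_
    have ha : atm Y l m w ≤ atm Y α m w :=
      ENNReal.toReal_mono (measure_ne_top _ _) (hlα _)
    have hb : atm Y l m w ≤ atm Y β m w :=
      ENNReal.toReal_mono (measure_ne_top _ _) (hlβ _)
    have h0 := atm_nonneg Y l m w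
    calc atm Y l m w = √(atm Y l m w) * √(atm Y l m w) := (Real.mul_self_sqrt h0).symm
      _ ≤ √(atm Y α m w) * √(atm Y β m w) := by gcongr
      _ ≤ _ := by
        have : 0 ≤ √(atm Y α m w) * √(atm Y β m w) := by positivity
        linarith
  have h0 : l.real univ ≤ 0 := by
    have := ge_of_tendsto' (h.const_mul 2) (fun j => key (n + j))
    simpa using this
  have h1 : l.real univ = 0 := le_antisymm h0 measureReal_nonneg
  rw [measureReal_eq_zero_iff, Measure.measure_univ_eq_zero] at h1
  rw [h1]; exact bot_le

lemma cyl_close {Y : ℕ → Ω → T} (hY : ∀ n, Measurable (Y n)) (α β : Measure Ω)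
    [IsProbabilityMeasure α] [IsProbabilityMeasure β] (m : ℕ) {δ : ℝ}
    (h : 1 - δ ≤ ∑ w, √(atm Y α m w) * √(atm Y β m w)) (E : Set (Fin (m + 1) → T)) :
    α.real (ppi Y m ⁻¹' E) ≤ 4 * δ + 2 * β.real (ppi Y m ⁻¹' E) := by
  classical
  obtain ⟨E, rfl⟩ : ∃ E' : Finset (Fin (m + 1) → T), E = ↑E' := ⟨E.toFinset, by simp⟩
  rw [real_cyl hY, real_cyl hY]
  have ha : ∑ w, atm Y α m w = 1 := by rw [← real_cyl hY]; simp
  have hb : ∑ w, atm Y β m w = 1 := by rw [← real_cyl hY]; simp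
  rw [← Finset.sum_add_sum_compl E] at h ha hb
  have h1 : ∑ w ∈ E, √(atm Y α m w) * √(atm Y β m w) ≤
      ∑ w ∈ E, (atm Y α m w / 4 + atm Y β m w) := by
    refine Finset.sum_le_sum fun w _ => ?_
    have h1 := Real.sq_sqrt (atm_nonneg Y α m w)
    have h2 := Real.sq_sqrt (atm_nonneg Y β m w)
    nlinarith [sq_nonneg (√(atm Y α m w) / 2 - √(atm Y β m w))]
  have h2 : ∑ w ∈ Eᶜ, √(atm Y α m w) * √(atm Y β m w) ≤
      ∑ w ∈ Eᶜ, (atm Y α m w / 2 + atm Y β m w / 2) := by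
    refine Finset.sum_le_sum fun w _ => ?_
    have h1 := Real.sq_sqrt (atm_nonneg Y α m w)
    have h2 := Real.sq_sqrt (atm_nonneg Y β m w)
    nlinarith [sq_nonneg (√(atm Y α m w) - √(atm Y β m w))]
  rw [Finset.sum_add_distrib, ← Finset.sum_div] at h1
  rw [Finset.sum_add_distrib, ← Finset.sum_div, ← Finset.sum_div] at h2
  linarith

/-- cylinder sets -/
def Cyl (Y : ℕ → Ω → T) : Set (Set Ω) :=
  {A | ∃ m, ∃ E : Set (Fin (m + 1) → T), A = ppi Y m ⁻¹' E}

lemma cyl_lift (Y : ℕ → Ω → T) {m n : ℕ} (h : m ≤ n) (E : Set (Fin (m + 1) → T)) :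
    ppi Y m ⁻¹' E = ppi Y n ⁻¹' ((fun w i => w (Fin.castLE (by omega) i)) ⁻¹' E) := by
  rw [← preimage_comp]; rfl

lemma cyl_alg (Y : ℕ → Ω → T) : IsSetAlgebra (Cyl Y) where
  empty_mem := ⟨0, ∅, by simp⟩
  compl_mem := by
    rintro _ ⟨m, E, rfl⟩
    exact ⟨m, Eᶜ, by simp⟩
  union_mem := by
    rintro _ _ ⟨m, E, rfl⟩ ⟨n, F, rfl⟩
    rw [cyl_lift Y (le_max_left m n) E, cyl_lift Y (le_max_right m n) F]
    exact ⟨max m n, _, (preimage_union).symm⟩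

lemma null_close {Y : ℕ → Ω → T} (hY : ∀ n, Measurable (Y n))
    (hgen : (inferInstance : MeasurableSpace Ω) = MeasurableSpace.generateFrom (Cyl Y))
    (α β : Measure Ω)
    [IsProbabilityMeasure α] [IsProbabilityMeasure β] (n : ℕ) {δ : ℝ}
    (h : ∀ j, 1 - δ ≤ ∑ w, √(atm Y α (n + j) w) * √(atm Y β (n + j) w))
    {A : Set Ω} (hA : MeasurableSet A) (hβA : β A = 0) : α.real A ≤ 4 * δ := by
  refine le_of_forall_pos_le_add fun ε hε => ?_
  obtain ⟨E, ⟨m, F, rfl⟩, hE⟩ := exists_measure_symmDiff_lt_of_generateFrom_isSetRing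
    (μ := α + β) (cyl_alg Y).isSetRing
    ⟨{univ}, by simp, by simpa using (cyl_alg Y).univ_mem, by simp⟩ hgen hA
    (ε := ENNReal.ofReal (ε / 3)) (by simpa using hε)
  rw [cyl_lift Y (show m ≤ n + m by omega) F] at hE
  set E := (fun (w : Fin (n + m + 1) → T) (i : Fin (m + 1)) => w (Fin.castLE (by omega) i)) ⁻¹' F
  have hc := cyl_close hY α β (n + m) (h m) E
  have hEm : MeasurableSet (ppi Y (n + m) ⁻¹' E) := ppi_meas hY _ (Set.toFinite E).measurableSet
  have h1 : (α + β).real (symmDiff (ppi Y (n + m) ⁻¹' E) A) < ε / 3 := by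
    rw [measureReal_def]
    exact (ENNReal.lt_ofReal_iff_toReal_lt (measure_ne_top _ _)).1 hE
  rw [measureReal_add_apply] at h1
  have h2 := abs_measureReal_sub_le_measureReal_symmDiff (μ := α) hEm.nullMeasurableSet hA.nullMeasurableSet
  have h3 := abs_measureReal_sub_le_measureReal_symmDiff (μ := β) hEm.nullMeasurableSet hA.nullMeasurableSet
  have h4 : β.real A = 0 := by simp [measureReal_def, hβA]
  rw [abs_le] at h2 h3
  have h5 : 0 ≤ α.real (symmDiff (ppi Y (n + m) ⁻¹' E) A) := measureReal_nonneg
  have h6 : 0 ≤ β.real (symmDiff (ppi Y (n + m) ⁻¹' E) A) := measureReal_nonneg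
  linarith [h2.1, h3.2]

/-- the absolutely continuous half -/
lemma ac_of_summable {Y : ℕ → Ω → T} (hY : ∀ n, Measurable (Y n))
    (hgen : (inferInstance : MeasurableSpace Ω) = MeasurableSpace.generateFrom (Cyl Y))
    (α β : Measure Ω) [IsProbabilityMeasure α] [IsProbabilityMeasure β]
    {P Q : ℕ → T → T → ℝ} (hP : ∀ n s t, 0 ≤ P n s t) (hQ : ∀ n s t, 0 ≤ Q n s t) {n0 : ℕ}
    (hP1 : ∀ n, n0 ≤ n → ∀ s, ∑ t, P n s t = 1) (hQ1 : ∀ n, n0 ≤ n → ∀ s, ∑ t, Q n s t = 1)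
    (hα : MP Y α P n0) (hβ : MP Y β Q n0)
    (hloc : ∀ n w, atm Y β n w = 0 → atm Y α n w = 0)
    (hs : Summable fun k => ∑ u, dd P Q k u) : α ≪ β := by
  refine Measure.AbsolutelyContinuous.mk fun A hA hβA => ?_
  have hle : α.real A ≤ 0 := by
    refine le_of_forall_pos_le_add fun ε hε => ?_
    obtain ⟨n, hn, hcl⟩ := key_close hP hQ hP1 hQ1 hs (ε := ε / 4) (by positivity)
    set z : (Fin (n + 1) → T) → ℝ := fun w => atm Y α n w / atm Y β n w with hz
    have hz0 : ∀ w, 0 ≤ z w := fun w => div_nonneg (atm_nonneg _ _ _ _) (atm_nonneg _ _ _ _)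
    set γ : Measure Ω := β.withDensity (fun x => ENNReal.ofReal (z (ppi Y n x))) with hγ
    have hzm : Measurable (fun x => ENNReal.ofReal (z (ppi Y n x))) :=
      ENNReal.measurable_ofReal.comp ((measurable_of_finite z).comp (ppi_meas hY n))
    have hγ1 : ∀ w (B : Set Ω), MeasurableSet B → B ⊆ ppi Y n ⁻¹' {w} →
        γ.real B = z w * β.real B := by
      intro w B hB hBw
      rw [measureReal_def, hγ, withDensity_apply _ hB,
        setLIntegral_congr_fun (g := fun _ => ENNReal.ofReal (z w)) hB
          (fun x hx => by have : ppi Y n x = w := hBw hx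
                          simp only [this])]
      simp [measureReal_def, ENNReal.toReal_mul, ENNReal.toReal_ofReal (hz0 w)]
    have hatm : ∀ w, atm Y γ n w = atm Y α n w := by
      intro w
      rw [atm, hγ1 w _ (ppi_meas hY n (measurableSet_singleton w)) Subset.rfl]
      change z w * atm Y β n w = _
      by_cases h0 : atm Y β n w = 0
      · rw [h0, hloc n w h0, mul_zero]
      · exact div_mul_cancel₀ _ h0
    have hfin : IsFiniteMeasure γ := by
      obtain ⟨K, hK⟩ := (Set.finite_range z).bddAbove
      refine isFiniteMeasure_withDensity ?_
      refine ne_of_lt (lt_of_le_of_lt (lintegral_mono (g := fun _ => ENNReal.ofReal K)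
        fun x => ENNReal.ofReal_le_ofReal (hK ⟨_, rfl⟩)) ?_)
      simp
    have hprob : IsProbabilityMeasure γ := by
      constructor
      have h1 : γ.real univ = 1 := by
        have e := real_cyl hY γ n Finset.univ
        have e' := real_cyl hY α n Finset.univ
        simp only [hatm] at e
        rw [← e'] at e
        simpa using e
      rw [measureReal_def] at h1
      exact (ENNReal.toReal_eq_one_iff _).1 h1
    have hγMP : MP Y γ Q n := by
      intro m hm w t
      have hsub : ppi Y m ⁻¹' {w} ⊆ ppi Y n ⁻¹' {fun i => w (Fin.castLE (by omega) i)} := by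
        intro x hx
        have hx : ppi Y m x = w := hx
        change ppi Y n x = _
        rw [← hx]; rfl
      have hms : MeasurableSet (ppi Y m ⁻¹' {w}) := ppi_meas hY m (measurableSet_singleton w)
      have hms2 : MeasurableSet {x | ppi Y m x = w ∧ Y (m + 1) x = t} :=
        hms.inter (hY (m + 1) (measurableSet_singleton t))
      rw [atm, hγ1 _ _ hms hsub, hγ1 _ _ hms2 (fun x hx => hsub hx.1),
        hβ m (hn.trans hm), atm]
      ring
    have haff : ∀ j, 1 - ε / 4 ≤ ∑ w, √(atm Y α (n + j) w) * √(atm Y γ (n + j) w) := by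
      intro j
      have h1 := aff_formula (fun m hm => hα m (hn.trans hm)) hγMP n j le_rfl (fun _ => 1)
      simp only [mul_one, hatm, Real.mul_self_sqrt (atm_nonneg _ _ _ _)] at h1
      rw [h1]
      have h2 : ∑ w, atm Y α n w = 1 := by rw [← real_cyl hY]; simp
      calc 1 - ε / 4 = ∑ w, atm Y α n w * (1 - ε / 4) := by rw [← Finset.sum_mul, h2, one_mul]
        _ ≤ _ := Finset.sum_le_sum fun w _ =>
          mul_le_mul_of_nonneg_left (hcl j _) (atm_nonneg _ _ _ _)
    have := null_close hY hgen α γ n haff hA (withDensity_absolutelyContinuous _ _ hβA)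
    linarith
  have h1 : α.real A = 0 := le_antisymm hle measureReal_nonneg
  rwa [measureReal_eq_zero_iff] at h1

lemma sing_of_not_summable [DecidableEq T] {Y : ℕ → Ω → T} (hY : ∀ n, Measurable (Y n))
    (α β : Measure Ω) [IsProbabilityMeasure α] [IsProbabilityMeasure β]
    {P Q : ℕ → T → T → ℝ} (hP : ∀ n s t, 0 ≤ P n s t) (hQ : ∀ n s t, 0 ≤ Q n s t) {n0 : ℕ}
    (hP1 : ∀ n, n0 ≤ n → ∀ s, ∑ t, P n s t = 1) (hQ1 : ∀ n, n0 ≤ n → ∀ s, ∑ t, Q n s t = 1)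
    {c : ℝ} (hc : 0 < c) {N : ℕ}
    (hmix : ∀ n, n0 ≤ n → ∀ j, N ≤ j → ∀ s t, c ≤ opK P n j (fun u => if u = t then 1 else 0) s)
    (hα : MP Y α P n0) (hβ : MP Y β Q n0)
    (hs : ¬ Summable fun k => ∑ u, dd P Q k u) : α ⟂ₘ β := by
  refine sing_of_aff hY α β n0 ?_
  have h1 := fun j => aff_formula hα hβ n0 j le_rfl (fun _ => 1)
  simp only [mul_one] at h1
  simp only [h1]
  have : (0 : ℝ) = ∑ w, √(atm Y α n0 w) * √(atm Y β n0 w) * 0 := by simp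
  rw [this]
  refine tendsto_finsetSum _ fun w _ => Tendsto.const_mul _ ?_
  by_contra hcon
  exact hs (key_summable hP hQ hP1 hQ1 hc hmix n0 le_rfl _ hcon)

end Meas

section Field

lemma XX_meas (n : ℕ) : Measurable (XX (S := S) n) :=
  (measurable_pi_apply _).prodMk (measurable_pi_apply _)

lemma inner_coord (n : ℤ) (k : ℤ) (hk : |k| < n) :
    Measurable[innerSA S n] (fun x : ℤ → S => x k) := by
  letI : MeasurableSpace (ℤ → S) := innerSA S n
  have h1 : Measurable (fun (x : ℤ → S) (k : {k : ℤ // |k| < n}) => x (k : ℤ)) :=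
    comap_measurable _
  exact (measurable_pi_apply (⟨k, hk⟩ : {k : ℤ // |k| < n})).comp h1

lemma outer_coord (n : ℤ) (k : ℤ) (hk : n < |k|) :
    Measurable[outerSA S n] (fun x : ℤ → S => x k) := by
  letI : MeasurableSpace (ℤ → S) := outerSA S n
  have h1 : Measurable (fun (x : ℤ → S) (k : {k : ℤ // n < |k|}) => x (k : ℤ)) :=
    comap_measurable _
  exact (measurable_pi_apply (⟨k, hk⟩ : {k : ℤ // n < |k|})).comp h1

lemma acal_coord (n : ℕ) (k : ℤ) (hk : |k| ≤ n) :
    Measurable[Acal S n] (fun x : ℤ → S => x k) := by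
  letI : MeasurableSpace (ℤ → S) := Acal S n
  have h1 : Measurable (fun (x : ℤ → S) (k : {k : ℤ // |k| ≤ (n : ℤ)}) => x (k : ℤ)) :=
    comap_measurable _
  exact (measurable_pi_apply (⟨k, hk⟩ : {k : ℤ // |k| ≤ (n : ℤ)})).comp h1

lemma XX_inner (n : ℕ) (m : ℤ) (h : (n : ℤ) < m) : Measurable[innerSA S m] (XX (S := S) n) := by
  letI : MeasurableSpace (ℤ → S) := innerSA S m
  exact (inner_coord m _ (by simpa using h)).prodMk (inner_coord m _ (by simpa using h))

lemma XX_outer (n : ℕ) (m : ℤ) (h : m < n) : Measurable[outerSA S m] (XX (S := S) n) := by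
  letI : MeasurableSpace (ℤ → S) := outerSA S m
  exact (outer_coord m _ (by simpa using h)).prodMk (outer_coord m _ (by simpa using h))

lemma XX_acal (n : ℕ) (m : ℕ) (h : n ≤ m) : Measurable[Acal S m] (XX (S := S) n) := by
  letI : MeasurableSpace (ℤ → S) := Acal S m
  exact (acal_coord m _ (by simpa using h)).prodMk (acal_coord m _ (by simpa using h))

lemma cyl_gen : (inferInstance : MeasurableSpace (ℤ → S)) =
    MeasurableSpace.generateFrom (Cyl (XX (S := S))) := by
  apply le_antisymm
  · letI m0 : MeasurableSpace (ℤ → S) := MeasurableSpace.generateFrom (Cyl (XX (S := S)))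
    have hX : ∀ n, @Measurable _ _ m0 _ (XX (S := S) n) := by
      intro n A _
      refine MeasurableSpace.measurableSet_generateFrom ⟨n, {w | w (Fin.last n) ∈ A}, ?_⟩
      ext x; simp [ppi]
    have hk : ∀ k : ℤ, @Measurable _ _ m0 _ (fun x : ℤ → S => x k) := by
      intro k
      rcases le_total 0 k with h | h
      · have := measurable_snd.comp (hX k.toNat)
        have e : (Prod.snd ∘ XX k.toNat) = fun x : ℤ → S => x k := by
          ext x; simp [XX, Int.toNat_of_nonneg h]
        rwa [e] at this
      · have := measurable_fst.comp (hX (-k).toNat)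
        have e : (Prod.fst ∘ XX (-k).toNat) = fun x : ℤ → S => x k := by
          ext x
          simp only [XX, Function.comp]
          rw [Int.toNat_of_nonneg (by omega)]; simp
        rwa [e] at this
    refine iSup_le fun k => ?_
    exact (hk k).comap_le
  · refine MeasurableSpace.generateFrom_le ?_
    rintro _ ⟨m, E, rfl⟩
    exact ppi_meas XX_meas m (Set.toFinite E).measurableSet

/-- one step Markov property -/
lemma mf_step {ν : Measure (ℤ → S)} [IsProbabilityMeasure ν] (hMF : IsMarkovField ν)
    {P : ℕ → (S × S) → (S × S) → ℝ} (hPnn : ∀ n s t, 0 ≤ P n s t)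
    (hP : ∀ (n : ℕ) (s t : S × S),
      ν {x | XX n x = s ∧ XX (n + 1) x = t} = ENNReal.ofReal (P n s t) * ν {x | XX n x = s})
    (m : ℕ) (hm : 1 ≤ m) (A : Set (ℤ → S)) (hA : MeasurableSet[innerSA S m] A) (s t : S × S) :
    ν.real (A ∩ {x | XX m x = s} ∩ {x | XX (m + 1) x = t}) =
      ν.real (A ∩ {x | XX m x = s}) * P m s t := by
  have h := hMF m (by exact_mod_cast hm) A {x | XX (m + 1) x = t} hA
    (XX_outer (m + 1) m (by push_cast; omega) (measurableSet_singleton t)) s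
  change ν (A ∩ {x | XX (m + 1) x = t} ∩ {x | XX m x = s}) * ν {x | XX m x = s} =
    ν (A ∩ {x | XX m x = s}) * ν ({x | XX (m + 1) x = t} ∩ {x | XX m x = s}) at h
  have e1 : A ∩ {x | XX (m + 1) x = t} ∩ {x | XX m x = s} =
    A ∩ {x | XX m x = s} ∩ {x | XX (m + 1) x = t} := inter_right_comm _ _ _
  have e2 : {x : ℤ → S | XX (m + 1) x = t} ∩ {x | XX m x = s} =
    {x | XX m x = s ∧ XX (m + 1) x = t} := inter_comm _ _
  rw [e1, e2, hP, ← mul_assoc] at h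
  by_cases h0 : ν {x | XX m x = s} = 0
  · have h1 : ν (A ∩ {x | XX m x = s}) = 0 := measure_mono_null inter_subset_right h0
    have h2 : ν (A ∩ {x | XX m x = s} ∩ {x | XX (m + 1) x = t}) = 0 :=
      measure_mono_null inter_subset_left h1
    simp [measureReal_def, h1, h2]
  · have h3 := (ENNReal.mul_left_inj h0 (measure_ne_top _ _)).1 h
    rw [measureReal_def, h3, ENNReal.toReal_mul, ENNReal.toReal_ofReal (hPnn m s t)]
    rfl

lemma mf_MP {ν : Measure (ℤ → S)} [IsProbabilityMeasure ν] (hMF : IsMarkovField ν)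
    {P : ℕ → (S × S) → (S × S) → ℝ} (hPnn : ∀ n s t, 0 ≤ P n s t)
    (hP : ∀ (n : ℕ) (s t : S × S),
      ν {x | XX n x = s ∧ XX (n + 1) x = t} = ENNReal.ofReal (P n s t) * ν {x | XX n x = s}) :
    MP XX ν P 1 := by
  intro m hm w t
  have hA : MeasurableSet[innerSA S m] {x : ℤ → S | ∀ i : Fin m, XX i x = w i.castSucc} := by
    letI : MeasurableSpace (ℤ → S) := innerSA S m
    rw [Set.setOf_forall]
    exact MeasurableSet.iInter fun i =>
      XX_inner (S := S) i m (by exact_mod_cast i.2) (measurableSet_singleton (w i.castSucc))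
  have h := mf_step hMF hPnn hP m hm _ hA (w (Fin.last m)) t
  have e : {x : ℤ → S | ∀ i : Fin m, XX i x = w i.castSucc} ∩ {x | XX m x = w (Fin.last m)} =
      ppi XX m ⁻¹' {w} := by
    ext x
    simp [ppi, funext_iff, Fin.forall_fin_succ']
  rw [e] at h
  exact h

lemma mf_pair {ν : Measure (ℤ → S)} [IsProbabilityMeasure ν] (hMF : IsMarkovField ν)
    {P : ℕ → (S × S) → (S × S) → ℝ} (hPnn : ∀ n s t, 0 ≤ P n s t)
    (hP : ∀ (n : ℕ) (s t : S × S),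
      ν {x | XX n x = s ∧ XX (n + 1) x = t} = ENNReal.ofReal (P n s t) * ν {x | XX n x = s})
    (n : ℕ) (hn : 1 ≤ n) (j : ℕ) (s : S × S) (g : S × S → ℝ) :
    ∑ t, ν.real {x | XX n x = s ∧ XX (n + j) x = t} * g t =
      ν.real {x | XX n x = s} * opK P n j g s := by
  classical
  induction j generalizing g with
  | zero =>
    rw [Finset.sum_eq_single s]
    · simp [opK]
    · intro b _ hb
      have : {x : ℤ → S | XX n x = s ∧ XX (n + 0) x = b} = ∅ := by
        ext x; simp only [add_zero, mem_ofPred_eq, mem_empty_iff_false, iff_false]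
        rintro ⟨h1, h2⟩; exact hb (h2.symm.trans h1)
      rw [this]; simp
    · simp
  | succ j ih =>
    rw [opK, ← ih]
    have hst : ∀ t u, ν.real ({x | XX n x = s ∧ XX (n + j) x = u} ∩ {x | XX (n + j + 1) x = t}) =
        ν.real {x | XX n x = s ∧ XX (n + j) x = u} * P (n + j) u t := by
      intro t u
      rcases Nat.eq_zero_or_pos j with rfl | hj
      · by_cases hsu : s = u
        · subst hsu
          have := mf_step hMF hPnn hP n hn univ MeasurableSet.univ s t
          simpa using this
        · have : {x : ℤ → S | XX n x = s ∧ XX (n + 0) x = u} = ∅ := by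
            ext x; simp only [add_zero, mem_ofPred_eq, mem_empty_iff_false, iff_false]
            rintro ⟨h1, h2⟩; exact hsu (h1.symm.trans h2)
          rw [this]; simp
      · exact mf_step hMF hPnn hP (n + j) (by omega) {x | XX n x = s}
          (XX_inner n _ (by exact_mod_cast (by omega : n < n + j)) (measurableSet_singleton s)) u t
    have hsum : ∀ t, ν.real {x | XX n x = s ∧ XX (n + (j + 1)) x = t} =
        ∑ u, ν.real {x | XX n x = s ∧ XX (n + j) x = u} * P (n + j) u t := by
      intro t
      simp only [← hst]
      have hB : MeasurableSet {x : ℤ → S | XX n x = s ∧ XX (n + (j + 1)) x = t} :=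
        (XX_meas n (measurableSet_singleton s)).inter
          (XX_meas (n + (j + 1)) (measurableSet_singleton t))
      have h1 := sum_measureReal_preimage_singleton
        (μ := ν.restrict {x : ℤ → S | XX n x = s ∧ XX (n + (j + 1)) x = t})
        (Finset.univ : Finset (S × S)) (f := XX (S := S) (n + j))
        (fun y _ => XX_meas (n + j) (measurableSet_singleton y))
      simp only [Finset.coe_univ, preimage_univ, measureReal_restrict_apply_univ] at h1
      rw [← h1]
      refine Finset.sum_congr rfl fun u _ => ?_
      rw [measureReal_restrict_apply (XX_meas (n + j) (measurableSet_singleton u))]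
      congr 1
      ext x
      simp only [mem_inter_iff, mem_preimage, mem_singleton_iff, mem_ofPred_eq, add_assoc]
      tauto
    simp only [hsum, opA, Finset.sum_mul, Finset.mul_sum]
    rw [Finset.sum_comm]
    exact Finset.sum_congr rfl fun _ _ => Finset.sum_congr rfl fun _ _ => by ring

lemma classS_bound {ν : Measure (ℤ → S)} [IsProbabilityMeasure ν] (h : classS ν) :
    ∃ c : ℝ, 0 < c ∧ ∃ N : ℕ, 1 ≤ N ∧ ∀ n j, N ≤ n → N ≤ j → ∀ s t : S × S,
      c ≤ ν.real {x | XX n x = s ∧ XX (n + j) x = t} := by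
  classical
  have h1 : ∀ p : (S × S) × (S × S), ∃ c : ℝ, 0 < c ∧ ∃ N : ℕ, ∀ n j, N ≤ n → N ≤ j →
      c ≤ ν.real {x | XX n x = p.1 ∧ XX (n + j) x = p.2} := by
    rintro ⟨s, t⟩
    obtain ⟨c, hc0, hc⟩ := exists_between (h s t)
    have hev := eventually_lt_of_lt_liminf hc
    rw [eventually_comap, eventually_atTop] at hev
    obtain ⟨N, hN⟩ := hev
    have hcfin : c ≠ ⊤ := ne_top_of_lt hc
    refine ⟨c.toReal, ENNReal.toReal_pos hc0.ne' hcfin, N, fun n j hn hj => ?_⟩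
    refine ENNReal.toReal_mono (measure_ne_top _ _) (hN (fmin (n, n + j)) ?_ (n, n + j) rfl).le
    simp only [fmin, Nat.dist]
    omega
  choose c hc N hN using h1
  have : Nonempty (S × S) := by
    obtain ⟨x⟩ := nonempty_of_isProbabilityMeasure ν
    exact ⟨(x 0, x 0)⟩
  obtain ⟨p0, hp0⟩ := Finite.exists_min c
  refine ⟨c p0, hc p0, (∑ p, N p) + 1, by omega, fun n j hn hj s t => ?_⟩
  have hle : N (s, t) ≤ ∑ p, N p := Finset.single_le_sum (fun _ _ => Nat.zero_le _)
    (Finset.mem_univ _)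
  exact (hp0 (s, t)).trans (hN (s, t) n j (by omega) (by omega))

lemma row_sum_s19 [DecidableEq (S × S)] {ν : Measure (ℤ → S)} [IsProbabilityMeasure ν] (hMF : IsMarkovField ν)
    {P : ℕ → (S × S) → (S × S) → ℝ} (hPnn : ∀ n s t, 0 ≤ P n s t)
    (hP : ∀ (n : ℕ) (s t : S × S),
      ν {x | XX n x = s ∧ XX (n + 1) x = t} = ENNReal.ofReal (P n s t) * ν {x | XX n x = s})
    (hS : classS ν) : ∃ N : ℕ, 1 ≤ N ∧ (∀ n, N ≤ n → ∀ s, ∑ t, P n s t = 1) ∧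
      ∃ c : ℝ, 0 < c ∧ ∀ n, N ≤ n → ∀ j, N ≤ j → ∀ s t,
        c ≤ opK P n j (fun u => if u = t then 1 else 0) s := by
  obtain ⟨c, hc, N, hN1, hN⟩ := classS_bound hS
  refine ⟨N, hN1, fun n hn s => ?_, c, hc, fun n hn j hj s t => ?_⟩
  · have hpos : 0 < ν.real {x | XX n x = s} :=
      (hc.trans_le (hN n N hn le_rfl s s)).trans_le (measureReal_mono fun x hx => hx.1)
    have h := mf_pair hMF hPnn hP n (by omega) 1 s (fun _ => 1)
    have h1 := sum_measureReal_preimage_singleton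
        (μ := ν.restrict {x : ℤ → S | XX n x = s})
        (Finset.univ : Finset (S × S)) (f := XX (S := S) (n + 1))
        (fun y _ => XX_meas (n + 1) (measurableSet_singleton y))
    simp only [Finset.coe_univ, preimage_univ, measureReal_restrict_apply_univ] at h1
    have h2 : ∑ t, ν.real {x | XX n x = s ∧ XX (n + 1) x = t} = ν.real {x | XX n x = s} := by
      rw [← h1]
      refine Finset.sum_congr rfl fun u _ => ?_
      rw [measureReal_restrict_apply (XX_meas (n + 1) (measurableSet_singleton u)), inter_comm]
      rfl
    simp only [mul_one, h2, opK, opA, add_zero] at h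
    exact mul_left_cancel₀ hpos.ne' (by linarith)
  · have h := mf_pair hMF hPnn hP n (by omega) j s (fun u => if u = t then 1 else 0)
    simp only [mul_ite, mul_one, mul_zero, Finset.sum_ite_eq', Finset.mem_univ, if_true] at h
    have h1 := hN n j hn hj s t
    rw [h] at h1
    have h2 : 0 ≤ opK P n j (fun u => if u = t then 1 else 0) s :=
      opK_nonneg hPnn n j (fun u => by positivity) s
    have h3 : ν.real {x | XX n x = s} ≤ 1 := measureReal_le_one
    nlinarith

lemma dd_symm {T : Type*} [Fintype T] (P Q : ℕ → T → T → ℝ) (n : ℕ) (s : T) :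
    dd P Q n s = dd Q P n s :=
  Finset.sum_congr rfl fun t _ => by ring

end Field

/-- Theorem B (equivalence–singularity dichotomy): locally equivalent Markov fields
`ν, μ ∈ 𝒮` are either equivalent or mutually singular, and they are equivalent if and only
if `∑_n D_n²(ν,μ) = ∑_n ∑_{s,t} (√(P_n(s,t)) - √(Q_n(s,t)))² < ∞`. -/
theorem stmt19 (ν μ : Measure (ℤ → S))
    [IsProbabilityMeasure ν] [IsProbabilityMeasure μ]
    (hMFν : IsMarkovField ν) (hMFμ : IsMarkovField μ)
    (P Q : ℕ → (S × S) → (S × S) → ℝ)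
    (hPnn : ∀ n s t, 0 ≤ P n s t) (hQnn : ∀ n s t, 0 ≤ Q n s t)
    (hP : ∀ (n : ℕ) (s t : S × S),
      ν {x | XX n x = s ∧ XX (n + 1) x = t} = ENNReal.ofReal (P n s t) * ν {x | XX n x = s})
    (hQ : ∀ (n : ℕ) (s t : S × S),
      μ {x | XX n x = s ∧ XX (n + 1) x = t} = ENNReal.ofReal (Q n s t) * μ {x | XX n x = s})
    (hSν : classS ν) (hSμ : classS μ)
    (hloc : ∀ n : ℕ, ∀ E : Set (ℤ → S), MeasurableSet[Acal S n] E →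
      (ν E = 0 ↔ μ E = 0)) :
    ((ν ≪ μ ∧ μ ≪ ν) ∨ ν ⟂ₘ μ) ∧
    ((ν ≪ μ ∧ μ ≪ ν) ↔ Summable (fun n : ℕ => ∑ s : S × S, ∑ t : S × S,
      (Real.sqrt (P n s t) - Real.sqrt (Q n s t)) ^ 2)) := by
  classical
  obtain ⟨N, hN1, hP1, c, hc, hmix⟩ := row_sum_s19 hMFν hPnn hP hSν
  obtain ⟨N', _, hQ1, -⟩ := row_sum_s19 hMFμ hQnn hQ hSμ
  have hMPν := mf_MP hMFν hPnn hP
  have hMPμ := mf_MP hMFμ hQnn hQ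
  have hMPν' : MP XX ν P (max N N') := fun m hm => hMPν m (by omega)
  have hMPμ' : MP XX μ Q (max N N') := fun m hm => hMPμ m (by omega)
  have hP1' : ∀ n, max N N' ≤ n → ∀ s, ∑ t, P n s t = 1 := fun n hn => hP1 n (by omega)
  have hQ1' : ∀ n, max N N' ≤ n → ∀ s, ∑ t, Q n s t = 1 := fun n hn => hQ1 n (by omega)
  have hatom : ∀ n w, atm (XX (S := S)) ν n w = 0 ↔ atm XX μ n w = 0 := by
    intro n w
    have hm : MeasurableSet[Acal S n] (ppi (XX (S := S)) n ⁻¹' {w}) := by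
      letI : MeasurableSpace (ℤ → S) := Acal S n
      have h1 : Measurable (ppi (XX (S := S)) n) :=
        measurable_pi_lambda _ fun i => XX_acal (S := S) i n (by omega)
      exact h1 (measurableSet_singleton w)
    have := hloc n _ hm
    simpa [atm, measureReal_eq_zero_iff] using this
  have hA : (Summable fun k => ∑ u, dd P Q k u) → ν ≪ μ ∧ μ ≪ ν := fun hs =>
    ⟨ac_of_summable XX_meas cyl_gen ν μ hPnn hQnn hP1' hQ1' hMPν' hMPμ'
      (fun n w => (hatom n w).2) hs,
     ac_of_summable XX_meas cyl_gen μ ν hQnn hPnn hQ1' hP1' hMPμ' hMPν'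
      (fun n w => (hatom n w).1) (by simpa only [dd_symm Q P] using hs)⟩
  have hB : (¬ Summable fun k => ∑ u, dd P Q k u) → ν ⟂ₘ μ := fun hs =>
    sing_of_not_summable XX_meas ν μ hPnn hQnn hP1' hQ1' hc
      (fun n hn j hj => hmix n (by omega) j hj) hMPν' hMPμ' hs
  change _ ∧ (_ ↔ Summable fun k => ∑ u, dd P Q k u)
  by_cases hs : Summable fun k => ∑ u, dd P Q k u
  · exact ⟨Or.inl (hA hs), fun _ => hs, fun _ => hA hs⟩
  · refine ⟨Or.inr (hB hs), fun h => ?_, fun h => absurd h hs⟩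
    have h0 := Measure.eq_zero_of_absolutelyContinuous_of_mutuallySingular h.1 (hB hs)
    exact absurd h0 (IsProbabilityMeasure.ne_zero ν)
end
end
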